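/- arXiv:2211.01069 — 2 statements merged into one kernel-verified Lean document; each statement's English description precedes it below -/
import Mathlib

section
/- (Janson's lower-tail inequality, as used in the paper.) Let {U_k}_{k∈K} be a finite family of {0,1}-valued random variables and let G be a dependency graph for the family: a graph with vertex set K such that whenever A and B are disjoint subsets of K with no edge of G between A and B, the families {U_k}_{k∈A} and {U_k}_{k∈B} are independent. Write i ∼ j when {i,j} is an edge of G. Let S = Σ_{k∈K} U_k, Δ = E[S], Ω = max_{i∈K} Σ_{j∼i} E[U_j], and Θ = (1/2)·Σ_{i∈K} Σ_{j∼i} E[U_i U_j], and assume Δ > 0 and Ω > 0. Then for every β ∈ [0,1], Pr{S ≤ βΔ} ≤ exp(−min{ (1−β)²·Δ²/(8Θ + 2Δ), (1−β)·Δ/(6Ω) }). -/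
open MeasureTheory ProbabilityTheory

lemma integrable_of_measurable_of_mem_Icc {α : Type*} [MeasurableSpace α]
    {μ : Measure α} [IsProbabilityMeasure μ] {f : α → ℝ} (hf : Measurable f)
    (h0 : ∀ ω, 0 ≤ f ω) (h1 : ∀ ω, f ω ≤ 1) : Integrable f μ :=
  Integrable.of_bound hf.aestronglyMeasurable 1
    (Filter.Eventually.of_forall fun ω => by
      rw [Real.norm_of_nonneg (h0 ω)]; exact h1 ω)

lemma measurable_prod_comap {α K : Type*} {U : K → α → ℝ} (f : ℝ → ℝ) (hf : Measurable f) (A : Finset K) :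
    Measurable[⨆ i ∈ (A : Set K), MeasurableSpace.comap (U i) inferInstance]
      (fun ω => ∏ i ∈ A, f (U i ω)) := by
  refine Finset.measurable_prod _ fun i hi => ?_
  refine hf.comp ?_
  refine Measurable.mono (comap_measurable (U i)) ?_ le_rfl
  exact le_iSup₂_of_le (f := fun i (_ : i ∈ (A : Set K)) =>
    MeasurableSpace.comap (U i) inferInstance) i (Finset.mem_coe.2 hi) le_rfl

lemma integral_prod_mul_prod_of_indep {α K : Type*} [MeasurableSpace α] {μ : Measure α}
    {U : K → α → ℝ}
    (hUmeas : ∀ k, Measurable (U k)) (A B : Finset K)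
    (h : Indep (⨆ i ∈ (A : Set K), MeasurableSpace.comap (U i) inferInstance)
      (⨆ j ∈ (B : Set K), MeasurableSpace.comap (U j) inferInstance) μ)
    (f g : ℝ → ℝ) (hf : Measurable f) (hg : Measurable g) :
    ∫ ω, (∏ i ∈ A, f (U i ω)) * ∏ j ∈ B, g (U j ω) ∂μ
      = (∫ ω, ∏ i ∈ A, f (U i ω) ∂μ) * ∫ ω, ∏ j ∈ B, g (U j ω) ∂μ := by
  have hind : IndepFun (fun ω => ∏ i ∈ A, f (U i ω)) (fun ω => ∏ j ∈ B, g (U j ω)) μ := by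
    rw [IndepFun_iff_Indep]
    exact indep_of_indep_of_le_left (indep_of_indep_of_le_right h
      (measurable_prod_comap g hg B).comap_le)
      (measurable_prod_comap f hf A).comap_le
  exact hind.integral_fun_mul_eq_mul_integral
    (Finset.measurable_prod _ fun i _ => hf.comp (hUmeas i)).aestronglyMeasurable
    (Finset.measurable_prod _ fun i _ => hg.comp (hUmeas i)).aestronglyMeasurable

lemma one_sub_mul_sum_le_prod_one_sub_mul {K : Type*} {u : ℝ} (hu0 : 0 ≤ u) (hu1 : u ≤ 1)
    {x : K → ℝ} (hx0 : ∀ k, 0 ≤ x k) (hx1 : ∀ k, x k ≤ 1) (A : Finset K) :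
    1 - u * ∑ k ∈ A, x k ≤ ∏ k ∈ A, (1 - u * x k) := by
  classical
  induction A using Finset.induction_on with
  | empty => simp
  | insert k A hk ih =>
    rw [Finset.sum_insert hk, Finset.prod_insert hk]
    have h0 := mul_nonneg hu0 (hx0 k)
    have h1 := mul_le_mul_of_nonneg_left ih (sub_nonneg.2 (mul_le_one₀ hu1 (hx0 k) (hx1 k)))
    have h2 := mul_nonneg h0 (mul_nonneg hu0 (Finset.sum_nonneg fun i (_ : i ∈ A) => hx0 i))
    linarith

/-- One-vertex recursion for `E ∏ (1 - u U_i)` along a dependency graph. -/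
lemma integral_prod_insert_le {α K : Type*} [DecidableEq K] [MeasurableSpace α]
    {μ : Measure α} [IsProbabilityMeasure μ] {U : K → α → ℝ}
    (hUmeas : ∀ k, Measurable (U k)) (hUval : ∀ k ω, U k ω = 0 ∨ U k ω = 1)
    (G : SimpleGraph K) [DecidableRel G.Adj]
    (hdep : ∀ A B : Set K, Disjoint A B →
      (∀ i ∈ A, ∀ j ∈ B, ¬ G.Adj i j) →
      Indep (⨆ i ∈ A, MeasurableSpace.comap (U i) inferInstance)
            (⨆ j ∈ B, MeasurableSpace.comap (U j) inferInstance) μ)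
    {u : ℝ} (hu0 : 0 ≤ u) (hu1 : u ≤ 1) {k : K} {A : Finset K} (hk : k ∉ A) :
    ∫ ω, ∏ i ∈ insert k A, (1 - u * U i ω) ∂μ ≤
      (1 - u * ∫ ω, U k ω ∂μ) * ∫ ω, ∏ i ∈ A, (1 - u * U i ω) ∂μ +
      u ^ 2 * ∑ j ∈ A with G.Adj k j, (∫ ω, U k ω * U j ω ∂μ) *
        ∫ ω, ∏ i ∈ A with (¬ G.Adj k i ∧ ¬ G.Adj j i), (1 - u * U i ω) ∂μ := by
  have hU0 : ∀ k ω, 0 ≤ U k ω := fun k ω => by rcases hUval k ω with h | h <;> simp [h]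
  have hU1 : ∀ k ω, U k ω ≤ 1 := fun k ω => by rcases hUval k ω with h | h <;> simp [h]
  have hW0 : ∀ (B : Finset K) ω, 0 ≤ ∏ i ∈ B, (1 - u * U i ω) := fun B ω =>
    Finset.prod_nonneg fun i _ => sub_nonneg.2 (mul_le_one₀ hu1 (hU0 i ω) (hU1 i ω))
  have hW1 : ∀ (B : Finset K) ω, ∏ i ∈ B, (1 - u * U i ω) ≤ 1 := fun B ω =>
    Finset.prod_le_one (fun i _ => sub_nonneg.2 (mul_le_one₀ hu1 (hU0 i ω) (hU1 i ω)))
      fun i _ => sub_le_self _ (mul_nonneg hu0 (hU0 i ω))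
  have hWm : ∀ B : Finset K, Measurable fun ω => ∏ i ∈ B, (1 - u * U i ω) := fun B =>
    Finset.measurable_prod _ fun i _ => measurable_const.sub ((hUmeas i).const_mul u)
  have hWanti : ∀ {B C : Finset K}, B ⊆ C → ∀ ω,
      ∏ i ∈ C, (1 - u * U i ω) ≤ ∏ i ∈ B, (1 - u * U i ω) := by
    intro B C hBC ω
    rw [← Finset.prod_sdiff hBC]
    exact mul_le_of_le_one_left (hW0 B ω) (hW1 _ ω)
  have hWi : ∀ B : Finset K, Integrable (fun ω => ∏ i ∈ B, (1 - u * U i ω)) μ := fun B =>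
    integrable_of_measurable_of_mem_Icc (hWm B) (hW0 B) (hW1 B)
  have hUWi : ∀ (k : K) (B : Finset K),
      Integrable (fun ω => U k ω * ∏ i ∈ B, (1 - u * U i ω)) μ := fun k B =>
    integrable_of_measurable_of_mem_Icc ((hUmeas k).mul (hWm B))
      (fun ω => mul_nonneg (hU0 k ω) (hW0 B ω))
      (fun ω => mul_le_one₀ (hU1 k ω) (hW0 B ω) (hW1 B ω))
  have hUUWi : ∀ (k j : K) (B : Finset K),
      Integrable (fun ω => U k ω * U j ω * ∏ i ∈ B, (1 - u * U i ω)) μ := fun k j B =>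
    integrable_of_measurable_of_mem_Icc (((hUmeas k).mul (hUmeas j)).mul (hWm B))
      (fun ω => mul_nonneg (mul_nonneg (hU0 k ω) (hU0 j ω)) (hW0 B ω))
      (fun ω => mul_le_one₀ (mul_le_one₀ (hU1 k ω) (hU0 j ω) (hU1 j ω)) (hW0 B ω) (hW1 B ω))
  have hmeas1 : Measurable fun x : ℝ => 1 - u * x := by fun_prop
  have hmain : (∫ ω, U k ω ∂μ) * ∫ ω, ∏ i ∈ A, (1 - u * U i ω) ∂μ ≤
      ∫ ω, U k ω * ∏ i ∈ A with ¬ G.Adj k i, (1 - u * U i ω) ∂μ := by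
    have hind := integral_prod_mul_prod_of_indep (μ := μ) hUmeas {k} {i ∈ A | ¬ G.Adj k i}
      (hdep _ _ (by
        rw [Finset.disjoint_coe, Finset.disjoint_singleton_left]
        simp [hk]) (by
        intro i hi j hj
        simp only [Finset.coe_singleton, Set.mem_singleton_iff] at hi
        subst hi
        simp at hj
        exact hj.2)) (fun x => x) (fun x => 1 - u * x) measurable_id hmeas1
    simp only [Finset.prod_singleton] at hind
    rw [hind]
    exact mul_le_mul_of_nonneg_left
      (integral_mono (hWi _) (hWi _) (hWanti (Finset.filter_subset _ _)))
      (integral_nonneg (hU0 k))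
  have hpair : ∀ j ∈ A.filter (fun j => G.Adj k j),
      ∫ ω, U k ω * U j ω * ∏ i ∈ A with ¬ G.Adj k i, (1 - u * U i ω) ∂μ ≤
      (∫ ω, U k ω * U j ω ∂μ) *
        ∫ ω, ∏ i ∈ A with (¬ G.Adj k i ∧ ¬ G.Adj j i), (1 - u * U i ω) ∂μ := by
    intro j hj
    rw [Finset.mem_filter] at hj
    have hne : k ≠ j := hj.2.ne
    have hind := integral_prod_mul_prod_of_indep (μ := μ) hUmeas {k, j}
      {i ∈ A | ¬ G.Adj k i ∧ ¬ G.Adj j i}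
      (hdep _ _ (by
        rw [Finset.disjoint_coe, Finset.disjoint_left]
        intro i hi hi'
        simp only [Finset.mem_insert, Finset.mem_singleton] at hi
        rw [Finset.mem_filter] at hi'
        rcases hi with rfl | rfl
        · exact hk hi'.1
        · exact hi'.2.1 hj.2) (by
        intro i hi l hl
        simp only [Finset.coe_insert, Finset.coe_singleton, Set.mem_insert_iff,
          Set.mem_singleton_iff] at hi
        rw [Finset.mem_coe, Finset.mem_filter] at hl
        rcases hi with rfl | rfl
        · exact hl.2.1
        · exact hl.2.2)) (fun x => x) (fun x => 1 - u * x) measurable_id hmeas1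
    simp only [Finset.prod_pair hne] at hind
    rw [← hind]
    refine integral_mono (hUUWi _ _ _) (hUUWi _ _ _) fun ω => ?_
    refine mul_le_mul_of_nonneg_left (hWanti ?_ ω) (mul_nonneg (hU0 k ω) (hU0 j ω))
    exact Finset.monotone_filter_right _ fun i _ hi => hi.1
  have hlow : ∫ ω, U k ω * ∏ i ∈ A with ¬ G.Adj k i, (1 - u * U i ω) ∂μ
      - u * ∑ j ∈ A with G.Adj k j,
        ∫ ω, U k ω * U j ω * ∏ i ∈ A with ¬ G.Adj k i, (1 - u * U i ω) ∂μ
      ≤ ∫ ω, U k ω * ∏ i ∈ A, (1 - u * U i ω) ∂μ := by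
    rw [← integral_finsetSum _ fun j _ => hUUWi k j _, ← integral_const_mul,
      ← integral_sub (hUWi _ _) ((integrable_finsetSum _ fun j _ => hUUWi k j _).const_mul u)]
    refine integral_mono ((hUWi _ _).sub
      ((integrable_finsetSum _ fun j _ => hUUWi k j _).const_mul u)) (hUWi _ _) fun ω => ?_
    have h1 := one_sub_mul_sum_le_prod_one_sub_mul hu0 hu1 (fun i => hU0 i ω)
      (fun i => hU1 i ω) (A.filter fun j => G.Adj k j)
    have h2 := mul_le_mul_of_nonneg_left h1
      (mul_nonneg (hU0 k ω) (hW0 (A.filter fun i => ¬ G.Adj k i) ω))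
    have h3 := Finset.prod_filter_mul_prod_filter_not A (fun j => G.Adj k j)
      fun i => 1 - u * U i ω
    have h4 : ∑ j ∈ A with G.Adj k j,
        U k ω * U j ω * ∏ i ∈ A with ¬ G.Adj k i, (1 - u * U i ω)
        = U k ω * (∏ i ∈ A with ¬ G.Adj k i, (1 - u * U i ω)) *
          ∑ j ∈ A with G.Adj k j, U j ω := by
      rw [Finset.mul_sum]
      exact Finset.sum_congr rfl fun j _ => by ring
    simp only
    rw [← h3, h4]
    linarith
  have hexp : ∫ ω, ∏ i ∈ insert k A, (1 - u * U i ω) ∂μ =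
      ∫ ω, ∏ i ∈ A, (1 - u * U i ω) ∂μ - u * ∫ ω, U k ω * ∏ i ∈ A, (1 - u * U i ω) ∂μ := by
    rw [← integral_const_mul, ← integral_sub (hWi _) ((hUWi _ _).const_mul u)]
    refine integral_congr_ae (Filter.Eventually.of_forall fun ω => ?_)
    simp only [Finset.prod_insert hk]
    ring
  have hsum := Finset.sum_le_sum hpair
  have h5 := mul_le_mul_of_nonneg_left hsum (sq_nonneg u)
  have h6 := mul_le_mul_of_nonneg_left (hlow) hu0
  have h7 := mul_le_mul_of_nonneg_left hmain hu0
  rw [hexp]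
  linarith

/-- If a set function `φ` satisfies the one-vertex recursion of a dependency graph with
neighbourhood weights at most `D`, then it decays exponentially. -/
lemma le_exp_of_insert_recursion {K : Type*} [DecidableEq K] (G : SimpleGraph K) [DecidableRel G.Adj]
    (φ : Finset K → ℝ) (p : K → ℝ) (r : K → K → ℝ) {u D : ℝ} (hu0 : 0 ≤ u)
    (hempty : φ ∅ ≤ 1)
    (hp0 : ∀ k, 0 ≤ p k) (hr0 : ∀ i j, 0 ≤ r i j) (hr : ∀ i j, r i j = r j i)
    (hup : ∀ k, u * p k ≤ 1)
    (hD : ∀ (i : K) (A : Finset K), ∑ j ∈ A with G.Adj i j, p j ≤ D)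
    (huD : Real.exp (2 * (u * D)) ≤ 2)
    (hrec : ∀ k A, k ∉ A → φ (insert k A) ≤ (1 - u * p k) * φ A +
      u ^ 2 * ∑ j ∈ A with G.Adj k j, r k j *
        φ {i ∈ A | ¬ G.Adj k i ∧ ¬ G.Adj j i}) (A : Finset K) :
    φ A ≤ Real.exp (-(u * ∑ i ∈ A, p i) +
      u ^ 2 * ∑ i ∈ A, ∑ j ∈ A with G.Adj i j, r i j) := by
  induction A using Finset.strongInduction with
  | H A ih =>
  rcases A.eq_empty_or_nonempty with rfl | ⟨k, hkA⟩
  · simpa using hempty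
  obtain ⟨A, hk, rfl⟩ : ∃ B, k ∉ B ∧ insert k B = A :=
    ⟨A.erase k, Finset.notMem_erase _ _, Finset.insert_erase hkA⟩
  set ψ : Finset K → ℝ := fun A => Real.exp (-(u * ∑ i ∈ A, p i) +
      u ^ 2 * ∑ i ∈ A, ∑ j ∈ A with G.Adj i j, r i j) with hψ
  set R := ∑ j ∈ A with G.Adj k j, r k j with hR
  have hss : ∀ {B}, B ⊆ A → B ⊂ insert k A := fun h =>
    lt_of_le_of_lt h (Finset.ssubset_insert hk)
  have hA : φ A ≤ ψ A := ih A (hss subset_rfl)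
  have hR0 : 0 ≤ R := Finset.sum_nonneg fun j _ => hr0 k j
  have hfar : ∀ j ∈ A.filter (fun j => G.Adj k j),
      φ {i ∈ A | ¬ G.Adj k i ∧ ¬ G.Adj j i} ≤ 2 * Real.exp (-(u * p k)) * ψ A := by
    intro j hj
    rw [Finset.mem_filter] at hj
    set B := A.filter (fun i => ¬ G.Adj k i ∧ ¬ G.Adj j i) with hB
    have hBA : B ⊆ A := Finset.filter_subset _ _
    have hθ : ∑ i ∈ B, ∑ j ∈ B with G.Adj i j, r i j ≤
        ∑ i ∈ A, ∑ j ∈ A with G.Adj i j, r i j :=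
      (Finset.sum_le_sum fun i _ => Finset.sum_le_sum_of_subset_of_nonneg
        (Finset.filter_subset_filter _ hBA) fun _ _ _ => hr0 _ _).trans
      (Finset.sum_le_sum_of_subset_of_nonneg hBA fun i _ _ =>
        Finset.sum_nonneg fun _ _ => hr0 _ _)
    have hp : ∑ i ∈ A, p i + p k ≤ ∑ i ∈ B, p i + 2 * D := by
      have h1 := hD k A
      have h2 := hD j (insert k A)
      rw [Finset.filter_insert, if_pos hj.2.symm, Finset.sum_insert (by simp [hk])] at h2
      have h3 : ∑ i ∈ A, p i ≤ ∑ i ∈ B, p i + ∑ i ∈ A with G.Adj k i, p i +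
          ∑ i ∈ A with G.Adj j i, p i := by
        rw [hB, Finset.sum_filter, Finset.sum_filter, Finset.sum_filter,
          ← Finset.sum_add_distrib, ← Finset.sum_add_distrib]
        refine Finset.sum_le_sum fun i _ => ?_
        have := hp0 i
        by_cases a : G.Adj k i <;> by_cases b : G.Adj j i <;> simp [a, b, this]
      linarith
    refine (ih B (hss hBA)).trans ?_
    calc _ ≤ Real.exp (2 * (u * D) + -(u * p k) + (-(u * ∑ i ∈ A, p i) +
            u ^ 2 * ∑ i ∈ A, ∑ j ∈ A with G.Adj i j, r i j)) := by
          rw [Real.exp_le_exp]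
          have h1 := mul_le_mul_of_nonneg_left hp hu0
          have h2 := mul_le_mul_of_nonneg_left hθ (sq_nonneg u)
          linarith
      _ ≤ _ := by
          rw [Real.exp_add, Real.exp_add]
          gcongr
  have hsum : ∑ j ∈ A with G.Adj k j, r k j * φ {i ∈ A | ¬ G.Adj k i ∧ ¬ G.Adj j i} ≤
      R * (2 * Real.exp (-(u * p k)) * ψ A) := by
    rw [hR, Finset.sum_mul]
    exact Finset.sum_le_sum fun j hj => mul_le_mul_of_nonneg_left (hfar j hj) (hr0 k j)
  have hθ : ∑ i ∈ insert k A, ∑ j ∈ insert k A with G.Adj i j, r i j =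
      ∑ i ∈ A, ∑ j ∈ A with G.Adj i j, r i j + 2 * R := by
    have hcol : ∑ i ∈ A, (if G.Adj i k then r i k else 0) = R := by
      rw [hR, Finset.sum_filter]
      refine Finset.sum_congr rfl fun i _ => ?_
      simp only [G.adj_comm i k, hr i k]
    simp only [Finset.sum_filter] at hR ⊢
    rw [Finset.sum_insert hk]
    simp only [Finset.sum_insert hk, Finset.sum_add_distrib, hcol, SimpleGraph.irrefl,
      if_false, zero_add]
    rw [hR]; ring
  have hψins : ψ (insert k A) = ψ A * Real.exp (-(u * p k)) * Real.exp (2 * u ^ 2 * R) := by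
    simp only [hψ]
    rw [hθ, Finset.sum_insert hk, ← Real.exp_add, ← Real.exp_add]
    congr 1; ring
  have hψ0 : 0 < ψ A := Real.exp_pos _
  change _ ≤ ψ (insert k A)
  calc φ (insert k A) ≤ (1 - u * p k) * φ A + u ^ 2 * _ := hrec k A hk
    _ ≤ (1 - u * p k) * ψ A + u ^ 2 * (R * (2 * Real.exp (-(u * p k)) * ψ A)) := by
      have := sub_nonneg.2 (hup k)
      gcongr
    _ ≤ Real.exp (-(u * p k)) * ψ A + u ^ 2 * (R * (2 * Real.exp (-(u * p k)) * ψ A)) := by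
      have := Real.add_one_le_exp (-(u * p k))
      gcongr
      linarith
    _ = ψ A * Real.exp (-(u * p k)) * (2 * u ^ 2 * R + 1) := by ring
    _ ≤ _ := by
      rw [hψins]
      gcongr
      exact Real.add_one_le_exp _

lemma exp_neg_le_one_sub_add_sq_div_two {s : ℝ} (hs : 0 ≤ s) :
    Real.exp (-s) ≤ 1 - s + s ^ 2 / 2 := by
  rw [Real.exp_neg, inv_le_iff_one_le_mul₀ (Real.exp_pos s)]
  have h1 := Real.quadratic_le_exp_of_nonneg hs
  have h2 : 0 ≤ 1 - s + s ^ 2 / 2 := by nlinarith [sq_nonneg (s - 1)]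
  nlinarith [mul_le_mul_of_nonneg_left h1 h2, sq_nonneg (s ^ 2)]

/-- The choice of the exponential parameter in the lower-tail bound. -/
lemma neg_mul_add_sq_mul_le_neg_min {a b D : ℝ} (hb : 0 < b) (hD : 0 < D) :
    -(min (a / b) (1 / (3 * D)) * a) + min (a / b) (1 / (3 * D)) ^ 2 * b / 2 ≤
      -min (a ^ 2 / (2 * b)) (a / (6 * D)) := by
  rcases le_total (a / b) (1 / (3 * D)) with h | h
  · rw [min_eq_left h]
    refine le_trans (le_of_eq ?_) (neg_le_neg (min_le_left _ _))
    field_simp; ring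
  · rw [min_eq_right h]
    refine le_trans ?_ (neg_le_neg (min_le_right _ _))
    rw [le_div_iff₀ hb] at h
    have h3 : 0 < 1 / (3 * D) := by positivity
    have h4 : a / (6 * D) = 1 / (3 * D) * a / 2 := by field_simp; ring
    rw [h4]
    nlinarith [mul_le_mul_of_nonneg_left h h3.le]

/-- Janson's lower-tail inequality, Theorem 10 of Janson, as
used in the paper. `{U_k}_{k∈K}` is a finite family of `{0,1}`-valued random
variables and `G` a dependency graph for it: whenever `A` and `B` are disjoint
sets of indices with no edge of `G` between them, the σ-algebras generated by
`{U_k}_{k∈A}` and `{U_k}_{k∈B}` are independent. With `S = Σ_k U_k`, `Δ = E[S]`,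
`Ω = max_i Σ_{j∼i} E[U_j]`, `Θ = (1/2)Σ_i Σ_{j∼i} E[U_i U_j]`, `Δ > 0`, `Ω > 0`,
and `β ∈ [0,1]`:
`Pr{S ≤ βΔ} ≤ exp(−min{(1−β)²Δ²/(8Θ+2Δ), (1−β)Δ/(6Ω)})`. -/
theorem stmt_16
    {α K : Type*} [MeasurableSpace α] (μ : Measure α) [IsProbabilityMeasure μ]
    [Fintype K] [Nonempty K] [DecidableEq K]
    (U : K → α → ℝ) (hUmeas : ∀ k, Measurable (U k))
    (hUval : ∀ k ω, U k ω = 0 ∨ U k ω = 1)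
    (G : SimpleGraph K) [DecidableRel G.Adj]
    (hdep : ∀ A B : Set K, Disjoint A B →
      (∀ i ∈ A, ∀ j ∈ B, ¬ G.Adj i j) →
      Indep (⨆ i ∈ A, MeasurableSpace.comap (U i) inferInstance)
            (⨆ j ∈ B, MeasurableSpace.comap (U j) inferInstance) μ)
    (Δ Om Th : ℝ)
    (hΔ : Δ = ∑ k, ∫ ω, U k ω ∂μ)
    (hOm : Om = Finset.univ.sup' Finset.univ_nonempty
      (fun i => ∑ j ∈ Finset.univ.filter (fun j => G.Adj i j), ∫ ω, U j ω ∂μ))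
    (hTh : Th = (1 / 2) * ∑ i,
      ∑ j ∈ Finset.univ.filter (fun j => G.Adj i j), ∫ ω, U i ω * U j ω ∂μ)
    (hΔpos : 0 < Δ) (hOmpos : 0 < Om)
    (β : ℝ) (hβ : β ∈ Set.Icc (0 : ℝ) 1) :
    (μ {ω | ∑ k, U k ω ≤ β * Δ}).toReal ≤
      Real.exp (-min ((1 - β) ^ 2 * Δ ^ 2 / (8 * Th + 2 * Δ))
        ((1 - β) * Δ / (6 * Om))) := by
  have hU0 : ∀ k ω, 0 ≤ U k ω := fun k ω => by rcases hUval k ω with h | h <;> simp [h]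
  have hU1 : ∀ k ω, U k ω ≤ 1 := fun k ω => by rcases hUval k ω with h | h <;> simp [h]
  have hp0 : ∀ k, 0 ≤ ∫ ω, U k ω ∂μ := fun k => integral_nonneg (hU0 k)
  have hp1 : ∀ k, ∫ ω, U k ω ∂μ ≤ 1 := fun k => by
    simpa using integral_mono (μ := μ)
      (integrable_of_measurable_of_mem_Icc (hUmeas k) (hU0 k) (hU1 k))
      (integrable_const (1 : ℝ)) (hU1 k)
  have hr0 : ∀ i j, 0 ≤ ∫ ω, U i ω * U j ω ∂μ := fun i j =>
    integral_nonneg fun ω => mul_nonneg (hU0 i ω) (hU0 j ω)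
  have hD : ∀ (i : K) (A : Finset K),
      ∑ j ∈ A with G.Adj i j, ∫ ω, U j ω ∂μ ≤ Om := fun i A =>
    (Finset.sum_le_sum_of_subset_of_nonneg
      (Finset.filter_subset_filter _ (Finset.subset_univ A)) fun j _ _ => hp0 j).trans
      (hOm ▸ Finset.le_sup' (fun i => ∑ j ∈ Finset.univ.filter (fun j => G.Adj i j),
        ∫ ω, U j ω ∂μ) (Finset.mem_univ i))
  have hTh0 : 0 ≤ Th := by
    rw [hTh]
    exact mul_nonneg (by norm_num)
      (Finset.sum_nonneg fun i _ => Finset.sum_nonneg fun j _ => hr0 i j)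
  have ha : 0 ≤ (1 - β) * Δ := mul_nonneg (sub_nonneg.2 hβ.2) hΔpos.le
  have hb : 0 < 4 * Th + Δ := by linarith
  set s := min ((1 - β) * Δ / (4 * Th + Δ)) (1 / (3 * Om)) with hs
  have hs0 : 0 ≤ s := le_min (by positivity) (by positivity)
  set u := 1 - Real.exp (-s) with hu
  have hu0 : 0 ≤ u := sub_nonneg.2 (Real.exp_le_one_iff.2 (by linarith))
  have hu1 : u ≤ 1 := sub_le_self _ (Real.exp_pos _).le
  have hus : u ≤ s := by linarith [Real.add_one_le_exp (-s)]
  have hus' : s - s ^ 2 / 2 ≤ u := by linarith [exp_neg_le_one_sub_add_sq_div_two hs0]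
  have huD : Real.exp (2 * (u * Om)) ≤ 2 := by
    have h1 : u * Om ≤ 1 / 3 := by
      have : u ≤ 1 / (3 * Om) := hus.trans (min_le_right _ _)
      rw [le_div_iff₀ (by positivity)] at this
      linarith
    calc Real.exp (2 * (u * Om)) ≤ Real.exp (Real.log 2) := by
          rw [Real.exp_le_exp]; linarith [Real.log_two_gt_d9]
      _ = 2 := Real.exp_log two_pos
  have hφ := le_exp_of_insert_recursion G (fun A => ∫ ω, ∏ i ∈ A, (1 - u * U i ω) ∂μ)
    (fun k => ∫ ω, U k ω ∂μ) (fun i j => ∫ ω, U i ω * U j ω ∂μ) hu0 (by simp)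
    hp0 hr0 (fun i j => by simp only [mul_comm])
    (fun k => mul_le_one₀ hu1 (hp0 k) (hp1 k)) hD huD
    (fun k A hk => integral_prod_insert_le hUmeas hUval G hdep hu0 hu1 hk) Finset.univ
  have hpt : ∀ ω, Real.exp (-s * ∑ k, U k ω) = ∏ k, (1 - u * U k ω) := fun ω => by
    rw [Finset.mul_sum, Real.exp_sum]
    refine Finset.prod_congr rfl fun k _ => ?_
    rcases hUval k ω with h | h <;> simp [h, hu]
  have hmgf : mgf (fun ω => ∑ k, U k ω) μ (-s) = ∫ ω, ∏ k, (1 - u * U k ω) ∂μ := by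
    simp only [mgf, hpt]
  have hint : Integrable (fun ω => Real.exp (-s * ∑ k, U k ω)) μ :=
    integrable_of_measurable_of_mem_Icc
      ((Finset.measurable_sum _ fun k _ => hUmeas k).const_mul (-s)).exp
      (fun ω => (Real.exp_pos _).le)
      (fun ω => Real.exp_le_one_iff.2 (mul_nonpos_of_nonpos_of_nonneg (by linarith)
        (Finset.sum_nonneg fun k _ => hU0 k ω)))
  have hchern := measure_le_le_exp_mul_mgf (μ := μ) (β * Δ) (by linarith : -s ≤ 0) hint
  rw [hmgf] at hchern
  refine hchern.trans ((mul_le_mul_of_nonneg_left hφ (Real.exp_pos _).le).trans ?_)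
  have hTh2 : ∑ i, ∑ j ∈ Finset.univ.filter (fun j => G.Adj i j), ∫ ω, U i ω * U j ω ∂μ
      = 2 * Th := by rw [hTh]; ring
  rw [hTh2, ← hΔ, ← Real.exp_add, Real.exp_le_exp]
  have hopt := neg_mul_add_sq_mul_le_neg_min (a := (1 - β) * Δ) hb hOmpos
  rw [← hs, mul_pow, show 2 * (4 * Th + Δ) = 8 * Th + 2 * Δ by ring] at hopt
  refine le_trans ?_ hopt
  have h1 := mul_le_mul_of_nonneg_right hus' hΔpos.le
  have h2 := mul_le_mul_of_nonneg_right (pow_le_pow_left₀ hu0 hus 2) hTh0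
  linarith
end

section
/- (De Caen's bound.) Let {A_i}_{i∈I} be a finite family of events in a probability space, each with Pr(A_i) > 0. Then Pr(∪_{i∈I} A_i) ≥ Σ_{i∈I} Pr(A_i)² / (Σ_{j∈I} Pr(A_i ∩ A_j)). -/
open MeasureTheory

/-- The pointwise inequality behind de Caen's bound: for arbitrary weights `c i`, the sum over the
sets containing `x` of `2 c i - (c i) ^ 2 N(x)`, where `N(x)` counts these sets, is at most `1`. -/
theorem sum_weighted_indicator_le_indicator_iUnion {α I : Type*} [Fintype I]
    (A : I → Set α) (c : I → ℝ) (x : α) :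
    ∑ i, (2 * c i * (A i).indicator 1 x - c i ^ 2 * ∑ j, (A i ∩ A j).indicator 1 x) ≤
      (⋃ i, A i).indicator (1 : α → ℝ) x := by
  set N : ℝ := ∑ j, (A j).indicator 1 x with hN
  have hinter (i : I) : ∑ j, (A i ∩ A j).indicator (1 : α → ℝ) x = (A i).indicator 1 x * N := by
    simp only [hN, Finset.mul_sum, Set.inter_indicator_one, Pi.mul_apply]
  simp only [hinter]
  by_cases hx : x ∈ ⋃ i, A i
  · obtain ⟨k, hk⟩ := Set.mem_iUnion.1 hx
    have hNpos : 0 < N :=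
      Finset.sum_pos' (fun i _ => Set.indicator_nonneg (fun _ _ => zero_le_one) x)
        ⟨k, Finset.mem_univ k, by simp [hk]⟩
    calc _ ≤ ∑ i, (A i).indicator (1 : α → ℝ) x * N⁻¹ := by
          refine Finset.sum_le_sum fun i _ => ?_
          have hi : 0 ≤ (A i).indicator (1 : α → ℝ) x :=
            Set.indicator_nonneg (fun _ _ => zero_le_one) x
          have hsq : 2 * c i - c i ^ 2 * N ≤ N⁻¹ := by
            have h : N⁻¹ - (2 * c i - c i ^ 2 * N) = N⁻¹ * (1 - c i * N) ^ 2 := by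
              field_simp
              ring
            have : 0 ≤ N⁻¹ * (1 - c i * N) ^ 2 := by positivity
            linarith
          linarith [mul_le_mul_of_nonneg_left hsq hi]
      _ = (⋃ i, A i).indicator (1 : α → ℝ) x := by
          rw [← Finset.sum_mul, ← hN, mul_inv_cancel₀ hNpos.ne', Set.indicator_of_mem hx,
            Pi.one_apply]
  · have hxi (i : I) : x ∉ A i := fun h => hx (Set.mem_iUnion.2 ⟨i, h⟩)
    simp [hxi]

/-- de Caen's bound. For a finite family of events
`{A_i}_{i∈I}`, each of positive probability,
`Pr(∪_i A_i) ≥ Σ_i Pr(A_i)² / (Σ_j Pr(A_i ∩ A_j))`. -/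
theorem stmt_17
    {α I : Type*} [MeasurableSpace α] (μ : Measure α) [IsProbabilityMeasure μ]
    [Fintype I]
    (A : I → Set α) (hAmeas : ∀ i, MeasurableSet (A i))
    (hApos : ∀ i, 0 < (μ (A i)).toReal) :
    ∑ i, (μ (A i)).toReal ^ 2 / (∑ j, (μ (A i ∩ A j)).toReal) ≤
      (μ (⋃ i, A i)).toReal := by
  have hint {s : Set α} (hs : MeasurableSet s) : Integrable (s.indicator (1 : α → ℝ)) μ :=
    (integrable_const (1 : ℝ)).indicator hs
  have hval {s : Set α} (hs : MeasurableSet s) :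
      ∫ x, s.indicator (1 : α → ℝ) x ∂μ = (μ s).toReal := integral_indicator_one hs
  have hinter (i j : I) : MeasurableSet (A i ∩ A j) := (hAmeas i).inter (hAmeas j)
  have hunion : MeasurableSet (⋃ i, A i) := MeasurableSet.iUnion hAmeas
  set c : I → ℝ := fun i => (μ (A i)).toReal / ∑ j, (μ (A i ∩ A j)).toReal with hc
  have hfst (i : I) : Integrable (fun x => 2 * c i * (A i).indicator (1 : α → ℝ) x) μ :=
    (hint (hAmeas i)).const_mul _
  have hsnd (i : I) :
      Integrable (fun x => c i ^ 2 * ∑ j, (A i ∩ A j).indicator (1 : α → ℝ) x) μ :=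
    (integrable_finsetSum _ fun j _ => hint (hinter i j)).const_mul _
  have hdiff (i : I) : Integrable (fun x => 2 * c i * (A i).indicator (1 : α → ℝ) x -
      c i ^ 2 * ∑ j, (A i ∩ A j).indicator (1 : α → ℝ) x) μ :=
    (hfst i).sub (hsnd i)
  have hle := integral_mono (integrable_finsetSum Finset.univ fun i _ => hdiff i)
    (hint hunion) (sum_weighted_indicator_le_indicator_iUnion A c)
  rw [hval hunion, integral_finsetSum _ fun i _ => hdiff i] at hle
  refine le_trans (le_of_eq (Finset.sum_congr rfl fun i _ => ?_)) hle
  rw [integral_sub (hfst i) (hsnd i), integral_const_mul, integral_const_mul,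
    integral_finsetSum _ fun j _ => hint (hinter i j), hval (hAmeas i)]
  simp only [hval (hinter i _), hc]
  have hS : 0 < ∑ j, (μ (A i ∩ A j)).toReal :=
    Finset.sum_pos' (fun _ _ => ENNReal.toReal_nonneg)
      ⟨i, Finset.mem_univ i, by simpa using hApos i⟩
  field_simp
  ring
end
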